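/- arXiv:math/0602248 — 2 statements merged into one kernel-verified Lean document; each statement's English description precedes it below -/
import Mathlib

section
/- Let a, b be real numbers with a > b > 0 and set r = b^2/a (the critical offset, the semi-latus rectum of the ellipse). Let G(x,y,a,b,r) be the degree-twelve polynomial defined in the context. Then the two points (0, (a^2 - b^2)/a) and (0, -(a^2 - b^2)/a) lie on the variety V(G) and are critical points of G as a function of (x,y): at each of these two points G = 0, ∂G/∂x = 0 and ∂G/∂y = 0, where the partial derivatives are taken with respect to x and y with a, b, r held fixed. -/
set_option maxHeartbeats 2000000
set_option maxRecDepth 100000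

/-- The degree-twelve polynomial defining the parallel lines to the ellipse
b^2*y^2 + a^2*x^2 = a^2*b^2 at offset r. -/
noncomputable def GEll (x y a b r : ℝ) : ℝ :=
  6*b^4*x^4*a^4 - 4*y^6*b^4*a^2 - 6*a^6*x^4*b^2 - 4*b^6*x^2*a^4 + 6*b^4*x^2*a^6 + a^4*b^8 -
    2*y^2*b^8*a^2 + 6*y^2*b^6*x^2*a^2 + 6*a^6*y^2*x^2*b^2 - 10*b^4*x^2*a^4*y^2 + y^8*b^4 +
    b^8*r^4 + b^4*r^8 - 2*b^6*r^6 - 2*b^4*y^2*x^4*r^2 - 6*x^2*y^4*b^4*r^2 + 6*x^2*b^4*r^4*y^2 -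
    4*b^4*y^6*r^2 + 2*b^4*y^6*x^2 + y^4*b^4*x^4 + b^4*x^4*r^4 - 2*b^4*r^6*x^2 - 2*b^6*x^2*r^4 +
    6*y^4*b^4*r^4 - 2*b^8*y^2*r^2 + 6*b^6*r^4*y^2 - 4*b^4*r^6*y^2 + 6*a^4*y^2*b^6 +
    6*a^6*y^2*b^2*r^2 + 2*a^4*b^2*x^4*y^2 - 4*a^4*x^6*b^2 + 4*a^6*x^2*b^2*r^2 -
    8*b^4*x^2*a^4*r^2 + 10*a^4*x^4*b^2*r^2 - 6*b^4*r^2*a^2*x^2*y^2 - 6*a^4*x^2*b^2*r^2*y^2 -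
    8*a^4*x^2*b^2*r^4 - 6*b^4*r^2*a^2*x^4 + 4*b^4*r^4*a^2*x^2 - 6*y^4*a^4*b^2*x^2 -
    6*b^4*x^4*a^2*y^2 + 6*b^6*x^2*r^2*a^2 + 2*b^4*x^2*y^4*a^2 + 10*b^4*y^4*a^2*r^2 +
    4*b^6*y^2*r^2*a^2 - 8*b^4*y^2*r^4*a^2 - 8*b^4*y^2*a^4*r^2 + 2*r^6*a^2*b^4 + a^8*b^4 -
    6*a^4*y^4*r^2*b^2 + 4*a^4*y^2*r^4*b^2 - 2*a^8*b^2*x^2 + x^4*a^4*y^4 + 4*x^2*b^6*y^2*r^2 -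
    6*y^4*b^6*a^2 - 4*a^6*y^2*b^4 - 2*y^4*a^4*x^2*r^2 + 2*b^2*r^2*a^2*x^4*y^2 - 2*r^8*a^2*b^2 +
    r^8*a^4 + a^8*x^4 + a^4*x^8 - 4*a^4*x^6*r^2 + 6*a^4*x^4*r^4 + 2*b^2*r^2*a^2*x^6 -
    6*b^2*r^4*a^2*x^4 - 2*a^6*r^6 + 2*a^6*x^6 + a^8*r^4 + 2*y^6*b^2*a^2*x^2 - 2*r^6*a^4*y^2 +
    6*r^6*b^2*y^2*a^2 - 2*a^8*x^2*r^2 + y^4*a^4*r^4 - 6*y^4*b^2*r^4*a^2 - 2*a^6*y^2*r^4 +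
    4*x^2*a^6*y^2*r^2 + 6*x^2*a^4*y^2*r^4 + 2*y^4*b^2*x^2*a^2*r^2 - 10*x^2*b^2*y^2*r^4*a^2 +
    2*y^6*b^2*a^2*r^2 + 6*r^6*b^2*x^2*a^2 + 4*b^2*x^4*y^4*a^2 + 2*a^4*x^6*y^2 - 6*a^6*x^4*r^2 -
    4*r^6*a^4*x^2 + 2*b^2*x^6*a^2*y^2 + 6*r^4*a^6*x^2 - 6*a^4*x^4*r^2*y^2 + 2*b^6*y^6 -
    2*a^8*b^2*r^2 - 2*x^2*y^4*b^6 + 6*a^4*y^4*b^4 + y^4*b^8 - 6*y^4*b^6*r^2 - 2*x^4*a^6*y^2 -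
    2*a^6*b^6 + 2*b^6*r^4*a^2 - 2*b^8*r^2*a^2 + 2*b^4*a^6*r^2 - 6*b^4*a^4*r^4 + 2*r^2*a^4*b^6 +
    2*r^4*a^6*b^2 + 2*r^6*a^4*b^2

theorem GEll_zero (y a b r : ℝ) : GEll 0 y a b r =
    (((y - a)^2 - r^2) * ((y + a)^2 - r^2)) * ((a^2 - b^2)*(r^2 - b^2) + b^2*y^2)^2 := by
  unfold GEll
  ring

theorem GEll_neg (x y a b r : ℝ) : GEll (-x) y a b r = GEll x y a b r := by
  unfold GEll
  ring

theorem GEll_deriv_x (y a b r : ℝ) : deriv (fun t : ℝ => GEll t y a b r) 0 = 0 := by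
  have h := deriv_comp_neg (fun t : ℝ => GEll t y a b r) 0
  simp only [GEll_neg, neg_zero] at h
  linarith

theorem GEll_deriv_y (y a b r : ℝ) (h : (a^2 - b^2)*(r^2 - b^2) + b^2*y^2 = 0) :
    deriv (fun t : ℝ => GEll 0 t a b r) y = 0 := by
  simp only [GEll_zero]
  have hH : DifferentiableAt ℝ (fun t : ℝ => ((t - a)^2 - r^2) * ((t + a)^2 - r^2)) y := by
    fun_prop
  have hq : DifferentiableAt ℝ (fun t : ℝ => (a^2 - b^2)*(r^2 - b^2) + b^2*t^2) y := by
    fun_prop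
  have := (hH.hasDerivAt.mul (hq.hasDerivAt.pow 2)).deriv
  refine Eq.trans this ?_
  simp [h]

theorem ellipse_critical_offset_singular_points (a b r : ℝ) (hab : b < a) (hb : 0 < b)
    (hr : r = b^2/a) :
    (GEll 0 ((a^2 - b^2)/a) a b r = 0 ∧
     deriv (fun t : ℝ => GEll t ((a^2 - b^2)/a) a b r) 0 = 0 ∧
     deriv (fun t : ℝ => GEll 0 t a b r) ((a^2 - b^2)/a) = 0) ∧
    (GEll 0 (-((a^2 - b^2)/a)) a b r = 0 ∧
     deriv (fun t : ℝ => GEll t (-((a^2 - b^2)/a)) a b r) 0 = 0 ∧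
     deriv (fun t : ℝ => GEll 0 t a b r) (-((a^2 - b^2)/a)) = 0) := by
  have ha : a ≠ 0 := by linarith
  have h1 : (a^2 - b^2)*(r^2 - b^2) + b^2*((a^2 - b^2)/a)^2 = 0 := by
    subst hr
    field_simp
    ring
  have h2 : (a^2 - b^2)*(r^2 - b^2) + b^2*(-((a^2 - b^2)/a))^2 = 0 := by
    rw [neg_sq]
    exact h1
  refine ⟨⟨?_, GEll_deriv_x _ _ _ _, GEll_deriv_y _ _ _ _ h1⟩,
    ⟨?_, GEll_deriv_x _ _ _ _, GEll_deriv_y _ _ _ _ h2⟩⟩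
  · rw [GEll_zero, h1]
    ring
  · rw [GEll_zero, h2]
    ring
end

section
/- Let a, b be real numbers with a > b > 0 and set r = b^2/a (the critical offset, the semi-latus rectum of the hyperbola). Let H(x,y,a,b,r) be the degree-twelve polynomial defined in the context. Then the two points (0, (a^2 + b^2)/a) and (0, -(a^2 + b^2)/a) lie on the variety V(H) and are critical points of H as a function of (x,y): at each of these two points H = 0, ∂H/∂x = 0 and ∂H/∂y = 0, where the partial derivatives are taken with respect to x and y with a, b, r held fixed. -/
set_option maxHeartbeats 2000000
set_option maxRecDepth 100000

/-- The degree-twelve polynomial defining the parallel lines to the hyperbola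
b^2*y^2 - a^2*x^2 = a^2*b^2 at offset r. -/
noncomputable def HHyp (x y a b r : ℝ) : ℝ :=
  6*a^4*x^4*r^4 - 2*b^2*x^4*a^2*r^2*y^2 + 4*b^6*x^2*a^4 + 2*a^8*b^2*x^2 + 2*a^6*x^6 +
    6*y^4*a^2*b^6 - 2*a^4*b^2*x^4*y^2 + 4*a^4*x^6*b^2 - 6*a^6*x^2*b^2*y^2 - 4*a^6*x^2*b^2*r^2 -
    10*a^4*x^2*b^4*y^2 - 8*a^4*x^2*b^4*r^2 + 8*a^4*x^2*b^2*r^4 - 6*b^4*r^2*a^2*x^4 +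
    4*b^4*r^4*a^2*x^2 - 10*a^4*x^4*b^2*r^2 - 6*b^4*r^2*a^2*x^2*y^2 + 6*a^4*x^2*b^2*r^2*y^2 -
    6*b^4*x^4*a^2*y^2 + 2*b^4*x^2*y^4*a^2 - 6*b^6*x^2*r^2*a^2 + 10*b^4*y^4*a^2*r^2 -
    8*b^4*y^2*a^4*r^2 - 4*b^6*y^2*r^2*a^2 - 8*b^4*y^2*r^4*a^2 + 6*y^4*a^4*b^2*x^2 -
    2*a^2*y^2*b^8 + 6*b^4*y^4*a^4 - 4*b^4*y^6*a^2 - 6*y^2*a^4*b^6 + 6*a^4*x^4*b^4 -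
    4*y^2*a^6*b^4 - 6*y^2*a^6*r^2*b^2 + 6*y^4*a^4*r^2*b^2 - 4*y^2*a^4*r^4*b^2 + 2*a^6*b^6 +
    a^4*b^8 + 6*a^6*b^4*x^2 + 6*a^6*x^4*b^2 + b^8*r^4 + a^8*b^4 - 2*a^2*b^8*r^2 - 2*a^2*b^6*r^4 +
    2*b^6*x^2*r^4 - 4*b^6*x^2*y^2*r^2 + 6*b^2*x^4*a^2*r^4 + 4*a^6*x^2*r^2*y^2 -
    2*b^2*x^2*a^2*y^6 + 2*b^4*x^2*y^6 - 2*b^2*x^2*y^4*a^2*r^2 + 6*b^4*x^2*y^2*r^4 +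
    10*b^2*x^2*y^2*a^2*r^4 + 2*b^6*x^2*y^4 - 6*b^4*x^2*y^4*r^2 + a^4*x^8 + 2*b^6*r^6 + b^4*r^8 +
    6*a^6*x^2*r^4 - 6*a^6*x^4*r^2 - 2*a^8*x^2*r^2 - 6*a^4*b^4*r^4 - 2*a^4*b^6*r^2 -
    2*a^6*y^2*r^4 - 2*a^6*b^2*r^4 - 6*a^2*r^6*b^2*y^2 - 2*a^4*r^6*y^2 - 6*a^4*x^4*r^2*y^2 +
    6*a^2*y^4*b^2*r^4 + 2*a^8*b^2*r^2 + a^4*y^4*r^4 - 2*a^2*y^6*b^2*r^2 - 4*a^4*r^6*x^2 +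
    a^8*x^4 + 6*a^4*x^2*y^2*r^4 - 4*a^4*x^6*r^2 + a^8*r^4 + 2*a^4*x^6*y^2 - 2*a^6*x^4*y^2 -
    2*a^6*r^6 - 2*a^4*r^6*b^2 + 2*a^6*r^2*b^4 + a^4*y^4*x^4 + 2*a^2*r^8*b^2 -
    2*a^4*y^4*x^2*r^2 + 2*a^2*b^4*r^6 + a^4*r^8 + 6*y^4*b^4*r^4 + 6*y^4*b^6*r^2 -
    4*y^6*b^4*r^2 - 4*y^2*b^4*r^6 - 6*y^2*b^6*r^4 + y^4*b^8 + y^8*b^4 - 2*y^6*b^6 -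
    2*b^2*x^6*a^2*y^2 - 2*b^4*x^2*r^6 - 6*b^2*x^2*r^6*a^2 + b^4*x^4*y^4 - 4*b^2*x^4*y^4*a^2 +
    b^4*x^4*r^4 - 2*b^2*x^6*a^2*r^2 - 2*b^4*x^4*r^2*y^2 - 2*y^2*b^8*r^2 - 6*y^2*x^2*a^2*b^6

/-- On the axis `x = 0` the polynomial factors. -/
lemma HHyp_zero (y a b r : ℝ) : HHyp 0 y a b r =
    (((y - a)^2 - r^2) * ((y + a)^2 - r^2)) * (b^2*y^2 - (a^2 + b^2)*(b^2 + r^2))^2 := by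
  unfold HHyp
  ring

lemma HHyp_even (x y a b r : ℝ) : HHyp (-x) y a b r = HHyp x y a b r := by
  unfold HHyp
  simp only [(show Even 2 by decide).neg_pow, (show Even 4 by decide).neg_pow,
    (show Even 6 by decide).neg_pow, (show Even 8 by decide).neg_pow]

lemma deriv_zero_of_even (f : ℝ → ℝ) (h : ∀ x, f (-x) = f x) : deriv f 0 = 0 := by
  have h1 := deriv_comp_neg f 0
  rw [show (fun x => f (-x)) = f from funext h, neg_zero] at h1
  linarith

lemma HHyp_deriv_y (y a b r : ℝ)
    (hq : b^2*y^2 - (a^2 + b^2)*(b^2 + r^2) = 0) :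
    deriv (fun t : ℝ => HHyp 0 t a b r) y = 0 := by
  have hP : DifferentiableAt ℝ (fun t : ℝ => ((t - a)^2 - r^2) * ((t + a)^2 - r^2)) y := by
    fun_prop
  have hQ : DifferentiableAt ℝ (fun t : ℝ => b^2*t^2 - (a^2 + b^2)*(b^2 + r^2)) y := by
    fun_prop
  have h := hP.hasDerivAt.mul (hQ.hasDerivAt.pow 2)
  have e : (fun t : ℝ => HHyp 0 t a b r) =
      (fun t : ℝ => ((t - a)^2 - r^2) * ((t + a)^2 - r^2)) *
        (fun t : ℝ => b^2*t^2 - (a^2 + b^2)*(b^2 + r^2)) ^ 2 := by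
    funext t
    simp only [Pi.mul_apply, Pi.pow_apply]
    exact HHyp_zero t a b r
  rw [e, h.deriv]
  simp [hq]

theorem hyperbola_critical_offset_singular_points (a b r : ℝ) (hab : b < a) (hb : 0 < b)
    (hr : r = b^2/a) :
    (HHyp 0 ((a^2 + b^2)/a) a b r = 0 ∧
     deriv (fun t : ℝ => HHyp t ((a^2 + b^2)/a) a b r) 0 = 0 ∧
     deriv (fun t : ℝ => HHyp 0 t a b r) ((a^2 + b^2)/a) = 0) ∧
    (HHyp 0 (-((a^2 + b^2)/a)) a b r = 0 ∧
     deriv (fun t : ℝ => HHyp t (-((a^2 + b^2)/a)) a b r) 0 = 0 ∧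
     deriv (fun t : ℝ => HHyp 0 t a b r) (-((a^2 + b^2)/a)) = 0) := by
  have ha : a ≠ 0 := (hb.trans hab).ne'
  have hq : b^2*((a^2 + b^2)/a)^2 - (a^2 + b^2)*(b^2 + r^2) = 0 := by
    subst hr
    field_simp
    ring
  have hq2 : b^2*(-((a^2 + b^2)/a))^2 - (a^2 + b^2)*(b^2 + r^2) = 0 := by
    rw [neg_sq]
    exact hq
  refine ⟨⟨?_, deriv_zero_of_even _ fun x => HHyp_even x _ a b r, HHyp_deriv_y _ a b r hq⟩,
    ⟨?_, deriv_zero_of_even _ fun x => HHyp_even x _ a b r, HHyp_deriv_y _ a b r hq2⟩⟩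
  · rw [HHyp_zero, hq]
    ring
  · rw [HHyp_zero, hq2]
    ring
end
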